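/- The function f : ℝ × ℝ → ℝ defined by f(x, y) = x² / √y is convex on the convex set ℝ × (0, ∞); that is, for all (x₁,y₁), (x₂,y₂) with y₁ > 0, y₂ > 0 and all θ ∈ [0,1], f(θx₁ + (1−θ)x₂, θy₁ + (1−θ)y₂) ≤ θ f(x₁,y₁) + (1−θ) f(x₂,y₂). -/

import Mathlib

/-- The quadratic-over-linear function `x² / a` is jointly convex for `a > 0`. -/
theorem sq_div_convex_combination_le {x₁ x₂ a b θ : ℝ} (ha : 0 < a) (hb : 0 < b)
    (hθ₀ : 0 ≤ θ) (hθ₁ : θ ≤ 1) (hs : 0 < θ * a + (1 - θ) * b) :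
    (θ * x₁ + (1 - θ) * x₂) ^ 2 / (θ * a + (1 - θ) * b) ≤
      θ * (x₁ ^ 2 / a) + (1 - θ) * (x₂ ^ 2 / b) := by
  have h1 : 0 ≤ 1 - θ := sub_nonneg.mpr hθ₁
  rw [div_le_iff₀ hs, ← sub_nonneg]
  have key : (θ * (x₁ ^ 2 / a) + (1 - θ) * (x₂ ^ 2 / b)) * (θ * a + (1 - θ) * b) -
      (θ * x₁ + (1 - θ) * x₂) ^ 2 = θ * (1 - θ) * (x₁ * b - x₂ * a) ^ 2 / (a * b) := by
    field_simp
    ring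
  rw [key]
  positivity

/-- The function `f(x, y) = x² / √y` is convex on `ℝ × (0, ∞)`:
for all `(x₁,y₁), (x₂,y₂)` with `y₁ > 0`, `y₂ > 0` and all `θ ∈ [0,1]`,
`f(θx₁+(1−θ)x₂, θy₁+(1−θ)y₂) ≤ θ f(x₁,y₁) + (1−θ) f(x₂,y₂)`. -/
theorem stmt_0 (x₁ y₁ x₂ y₂ θ : ℝ) (hy₁ : 0 < y₁) (hy₂ : 0 < y₂)
    (hθ₀ : 0 ≤ θ) (hθ₁ : θ ≤ 1) :
    (θ * x₁ + (1 - θ) * x₂) ^ 2 / Real.sqrt (θ * y₁ + (1 - θ) * y₂) ≤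
      θ * (x₁ ^ 2 / Real.sqrt y₁) + (1 - θ) * (x₂ ^ 2 / Real.sqrt y₂) := by
  have h1 : 0 ≤ 1 - θ := sub_nonneg.mpr hθ₁
  have ha : 0 < √y₁ := Real.sqrt_pos.mpr hy₁
  have hb : 0 < √y₂ := Real.sqrt_pos.mpr hy₂
  have hs : 0 < θ * √y₁ + (1 - θ) * √y₂ :=
    convex_Ioi (𝕜 := ℝ) (0 : ℝ) ha hb hθ₀ h1 (add_sub_cancel θ 1)
  have hle : θ * √y₁ + (1 - θ) * √y₂ ≤ √(θ * y₁ + (1 - θ) * y₂) :=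
    Real.strictConcaveOn_sqrt.concaveOn.2 hy₁.le hy₂.le hθ₀ h1 (add_sub_cancel θ 1)
  exact (div_le_div_of_nonneg_left (sq_nonneg _) hs hle).trans
    (sq_div_convex_combination_le ha hb hθ₀ hθ₁ hs)
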